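/- arXiv:2310.20030 — 6 statements merged into one kernel-verified Lean document; each statement's English description precedes it below -/
import Mathlib

section
/- For every θ ∈ (−π, π), lim_{t→0⁺} −4t · log( (4πt)^{−1/2} Σ_{k∈ℤ} exp(−(θ+2πk)²/(4t)) ) = θ². That is, Varadhan's small-time asymptotic −4t log K_M(x|x₀,t) → dist_M(x₀,x)² holds on the circle, where for angular separation θ ∈ (−π,π) the geodesic distance is |θ|. -/
open Filter

lemma aux_gap (θ : ℝ) (hθ : θ ∈ Set.Ioo (-Real.pi) Real.pi) (k : ℤ) :
    (Real.pi - |θ|) * |(k : ℝ)| ≤ ((θ + 2 * Real.pi * (k : ℝ)) ^ 2 - θ ^ 2) / 4 := by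
  have hp := Real.pi_gt_three
  have h1 : |θ| < Real.pi := abs_lt.mpr hθ
  have h2 : -(|θ| * |(k : ℝ)|) ≤ θ * k := by
    rw [← abs_mul]; exact neg_abs_le _
  rcases eq_or_ne k 0 with rfl | hk
  · simp
  have hk1 : (1 : ℝ) ≤ |(k : ℝ)| := by exact_mod_cast Int.one_le_abs hk
  have h3 : ((θ + 2 * Real.pi * (k : ℝ)) ^ 2 - θ ^ 2) / 4
      = Real.pi * (θ * k + Real.pi * |(k : ℝ)| ^ 2) := by
    rw [sq_abs]; ring
  rw [h3]
  have h4 : (Real.pi - |θ|) * |(k : ℝ)| ≤ θ * k + Real.pi * |(k : ℝ)| ^ 2 := by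
    nlinarith [mul_nonneg (by linarith : (0:ℝ) ≤ |(k : ℝ)|) (by linarith : (0:ℝ) ≤ |(k : ℝ)| - 1)]
  have h5 : 0 ≤ (Real.pi - |θ|) * |(k : ℝ)| := mul_nonneg (by linarith) (by linarith)
  nlinarith

lemma aux_summable (c : ℝ) (hc : 0 < c) :
    Summable (fun k : ℤ => Real.exp (-(c * |(k : ℝ)|))) := by
  have h : Summable (fun n : ℕ => Real.exp (n * (-c))) :=
    Real.summable_exp_nat_mul_iff.mpr (by linarith)
  have h' : Summable (fun n : ℕ => Real.exp (-(c * n))) := by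
    refine h.congr fun n => ?_
    congr 1; ring
  refine Summable.of_nat_of_neg ?_ ?_
  · simpa using h'
  · simpa using h'

theorem circle_heat_kernel_varadhan_asymptotic
    (θ : ℝ) (hθ : θ ∈ Set.Ioo (-Real.pi) Real.pi) :
    Tendsto
      (fun t : ℝ => -4 * t *
        Real.log ((4 * Real.pi * t) ^ (-(1 : ℝ) / 2) *
          ∑' k : ℤ, Real.exp (-(θ + 2 * Real.pi * (k : ℝ)) ^ 2 / (4 * t))))
      (nhdsWithin 0 (Set.Ioi 0)) (nhds (θ ^ 2)) := by
  have hp := Real.pi_pos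
  have h1 : |θ| < Real.pi := abs_lt.mpr hθ
  have hsum := aux_summable (Real.pi - |θ|) (by linarith)
  set C := ∑' k : ℤ, Real.exp (-((Real.pi - |θ|) * |(k : ℝ)|)) with hC
  set R : ℝ → ℝ := fun t =>
    ∑' k : ℤ, Real.exp (-(((θ + 2 * Real.pi * (k : ℝ)) ^ 2 - θ ^ 2) / 4) / t) with hR
  have hle : ∀ t : ℝ, 0 < t → t < 1 → ∀ k : ℤ,
      Real.exp (-(((θ + 2 * Real.pi * (k : ℝ)) ^ 2 - θ ^ 2) / 4) / t)
        ≤ Real.exp (-((Real.pi - |θ|) * |(k : ℝ)|)) := by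
    intro t ht ht1 k
    have hg := aux_gap θ hθ k
    have h5 : 0 ≤ (Real.pi - |θ|) * |(k : ℝ)| := mul_nonneg (by linarith) (abs_nonneg _)
    apply Real.exp_le_exp.mpr
    rw [div_le_iff₀ ht]
    nlinarith
  have hRs : ∀ t : ℝ, 0 < t → t < 1 → Summable (fun k : ℤ =>
      Real.exp (-(((θ + 2 * Real.pi * (k : ℝ)) ^ 2 - θ ^ 2) / 4) / t)) := fun t ht ht1 =>
    Summable.of_nonneg_of_le (fun _ => (Real.exp_pos _).le) (hle t ht ht1) hsum
  have hRC : ∀ t : ℝ, 0 < t → t < 1 → R t ≤ C := fun t ht ht1 =>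
    (hRs t ht ht1).tsum_le_tsum (hle t ht ht1) hsum
  have hR1 : ∀ t : ℝ, 0 < t → t < 1 → 1 ≤ R t := by
    intro t ht ht1
    have := (hRs t ht ht1).le_tsum (0 : ℤ) (fun _ _ => (Real.exp_pos _).le)
    simpa using this
  have hev : ∀ᶠ t : ℝ in nhdsWithin 0 (Set.Ioi 0), 0 < t ∧ t < 1 :=
    Ioo_mem_nhdsGT (by norm_num : (0:ℝ) < 1)
  have ht0 : Tendsto (fun t : ℝ => t) (nhdsWithin 0 (Set.Ioi 0)) (nhds 0) :=
    tendsto_nhdsWithin_of_tendsto_nhds tendsto_id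
  have hlogR : Tendsto (fun t => t * Real.log (R t)) (nhdsWithin 0 (Set.Ioi 0)) (nhds 0) := by
    have hu : Tendsto (fun t : ℝ => t * Real.log C) (nhdsWithin 0 (Set.Ioi 0)) (nhds 0) := by
      simpa using ht0.mul_const (Real.log C)
    refine tendsto_of_tendsto_of_tendsto_of_le_of_le' tendsto_const_nhds hu ?_ ?_
    · filter_upwards [hev] with t ht
      exact mul_nonneg ht.1.le (Real.log_nonneg (hR1 t ht.1 ht.2))
    · filter_upwards [hev] with t ht
      exact mul_le_mul_of_nonneg_left
        (Real.log_le_log (by linarith [hR1 t ht.1 ht.2]) (hRC t ht.1 ht.2)) ht.1.le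
  have hlog : Tendsto (fun t : ℝ => t * Real.log t) (nhdsWithin 0 (Set.Ioi 0)) (nhds 0) := by
    have := Real.continuous_mul_log.tendsto 0
    simp only [zero_mul] at this
    exact tendsto_nhdsWithin_of_tendsto_nhds this
  have hmain : Tendsto (fun t : ℝ => 2 * (t * Real.log (4 * Real.pi)) + 2 * (t * Real.log t)
      + θ ^ 2 - 4 * (t * Real.log (R t))) (nhdsWithin 0 (Set.Ioi 0)) (nhds (θ ^ 2)) := by
    have := ((((ht0.mul_const (Real.log (4 * Real.pi))).const_mul 2).add
      (hlog.const_mul 2)).add_const (θ ^ 2)).sub (hlogR.const_mul 4)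
    simpa using this
  refine hmain.congr' ?_
  filter_upwards [hev] with t ht
  obtain ⟨ht, ht1⟩ := ht
  have hRp : 0 < R t := by linarith [hR1 t ht ht1]
  have hS : ∑' k : ℤ, Real.exp (-(θ + 2 * Real.pi * (k : ℝ)) ^ 2 / (4 * t))
      = Real.exp (-θ ^ 2 / (4 * t)) * R t := by
    rw [hR, ← tsum_mul_left]
    refine tsum_congr fun k => ?_
    rw [← Real.exp_add]
    congr 1
    field_simp
    ring
  have hq : 0 < 4 * Real.pi * t := by positivity
  rw [hS, Real.log_mul (Real.rpow_pos_of_pos hq _).ne' (by positivity),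
    Real.log_mul (Real.exp_pos _).ne' hRp.ne', Real.log_exp, Real.log_rpow hq,
    Real.log_mul (by positivity) ht.ne']
  field_simp
  ring
end

section
/- For every t > 0 and every θ ∈ ℝ, the sum over odd frequencies satisfies Σ_{m odd, m≥1} m·sin(mθ)·e^{−m²t} = (√π / (8 t^{3/2})) · Σ_{k∈ℤ} (−1)^k (θ + πk) · exp(−(θ+πk)²/(4t)). -/
theorem hasSum_int_even_odd {f : ℤ → ℝ} {a b : ℝ} (he : HasSum (fun k : ℤ => f (2 * k)) a)
    (ho : HasSum (fun k : ℤ => f (2 * k + 1)) b) : HasSum f (a + b) := by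
  have h2 : Function.Injective (fun k : ℤ => 2 * k) := fun x y h => by
    simp only at h; omega
  have h3 : Function.Injective (fun k : ℤ => 2 * k + 1) := fun x y h => by
    simp only at h; omega
  have he' := h2.hasSum_range_iff.2 he
  have ho' := h3.hasSum_range_iff.2 ho
  refine he'.add_isCompl ?_ ho'
  rw [isCompl_iff, Set.disjoint_iff_inter_eq_empty, codisjoint_iff]
  constructor
  · ext x
    simp only [Set.mem_inter_iff, Set.mem_range, Set.mem_empty_iff_false, iff_false]
    rintro ⟨⟨y, rfl⟩, z, hz⟩
    omega
  · change _ ∪ _ = Set.univ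
    ext x
    simp only [Set.mem_union, Set.mem_range, Set.mem_univ, iff_true]
    obtain ⟨m, h | h⟩ := x.even_or_odd'
    · exact Or.inl ⟨m, h.symm⟩
    · exact Or.inr ⟨m, h.symm⟩

theorem oddTheta_rhs (t θ : ℝ) (ht : 0 < t) :
    HasSum (fun n : ℤ => (θ + Real.pi * (2 * (n : ℝ))) *
        Real.exp (-(θ + Real.pi * (2 * (n : ℝ))) ^ 2 / (4 * t)))
      ((2 * t ^ ((3 : ℝ) / 2) / Real.sqrt Real.pi) *
        HurwitzZeta.sinKernel ((θ / (2 * Real.pi) : ℝ) : UnitAddCircle) (t / Real.pi)) := by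
  have hpi := Real.pi_pos
  have hx : 0 < Real.pi / t := by positivity
  have h := (HurwitzZeta.hasSum_int_oddKernel (θ / (2 * Real.pi)) hx).mul_left (2 * Real.pi)
  rw [HurwitzZeta.oddKernel_functional_equation, one_div_div] at h
  convert h using 1
  · rfl
  · funext n
    have e1 : (n : ℝ) + θ / (2 * Real.pi) = (θ + Real.pi * (2 * n)) / (2 * Real.pi) := by
      field_simp; ring
    rw [e1, ← mul_assoc (2 * Real.pi), mul_div_cancel₀ _ (by positivity : (2 * Real.pi) ≠ 0)]
    congr 2
    field_simp
    ring
  · rw [← mul_assoc]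
    congr 1
    rw [Real.div_rpow hpi.le ht.le]
    have e2 : Real.pi ^ ((3 : ℝ) / 2) = Real.pi * Real.sqrt Real.pi := by
      rw [show (3 : ℝ) / 2 = 1 + 1 / 2 by norm_num, Real.rpow_add hpi, Real.rpow_one,
        Real.sqrt_eq_rpow]
    rw [e2]
    have : 0 < t ^ ((3 : ℝ) / 2) := by positivity
    have : 0 < Real.sqrt Real.pi := by positivity
    field_simp

theorem oddTheta_lhs (t θ : ℝ) (ht : 0 < t) :
    HasSum (fun n : ℕ => 2 * (n : ℝ) * Real.sin (n * θ) * Real.exp (-(n : ℝ) ^ 2 * t))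
      (HurwitzZeta.sinKernel ((θ / (2 * Real.pi) : ℝ) : UnitAddCircle) (t / Real.pi)) := by
  have hpi := Real.pi_pos
  have hx : 0 < t / Real.pi := by positivity
  convert HurwitzZeta.hasSum_nat_sinKernel (θ / (2 * Real.pi)) hx using 1
  funext n
  congr 1
  · congr 2
    field_simp
  · congr 1
    field_simp

/-- The odd-frequency part of the differentiated Jacobi theta transformation
(underlying the heat kernel on `SO(3)`): for every `t > 0` and `θ : ℝ`,
`Σ_{m odd, m≥1} m sin(mθ) e^{-m²t}
  = (√π / (8 t^{3/2})) Σ_{k∈ℤ} (-1)^k (θ+πk) e^{-(θ+πk)²/(4t)}`. -/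
theorem odd_frequency_jacobi_theta_transformation (t θ : ℝ) (ht : 0 < t) :
    ∑' j : ℕ, (2 * (j : ℝ) + 1) * Real.sin ((2 * (j : ℝ) + 1) * θ) *
        Real.exp (-(2 * (j : ℝ) + 1) ^ 2 * t)
      = (Real.sqrt Real.pi / (8 * t ^ ((3 : ℝ) / 2))) *
        ∑' k : ℤ, (-1 : ℝ) ^ k * (θ + Real.pi * (k : ℝ)) *
          Real.exp (-(θ + Real.pi * (k : ℝ)) ^ 2 / (4 * t)) := by
  have hL := (oddTheta_lhs t θ ht).sub (oddTheta_lhs t (θ + Real.pi) ht)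
  have hR1 := oddTheta_rhs t θ ht
  have hR2 := (oddTheta_rhs t (θ + Real.pi) ht).neg
  generalize HurwitzZeta.sinKernel ((θ / (2 * Real.pi) : ℝ) : UnitAddCircle) (t / Real.pi) = A
    at hL hR1
  generalize HurwitzZeta.sinKernel (((θ + Real.pi) / (2 * Real.pi) : ℝ) : UnitAddCircle)
    (t / Real.pi) = B at hL hR2
  have hinj : Function.Injective (fun j : ℕ => 2 * j + 1) := fun a b h => by
    simp only at h; omega
  rw [← hinj.hasSum_iff] at hL
  · have hL' : HasSum (fun j : ℕ => (2 * (j : ℝ) + 1) * Real.sin ((2 * (j : ℝ) + 1) * θ) *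
        Real.exp (-(2 * (j : ℝ) + 1) ^ 2 * t)) ((1 / 4) * (A - B)) := by
      convert hL.mul_left (1 / 4) using 1
      · rfl
      funext j
      have hs : Real.sin ((2 * (j : ℝ) + 1) * (θ + Real.pi))
          = - Real.sin ((2 * (j : ℝ) + 1) * θ) := by
        rw [show (2 * (j : ℝ) + 1) * (θ + Real.pi)
          = ((2 * (j : ℝ) + 1) * θ + Real.pi) + j * (2 * Real.pi) by ring,
          Real.sin_add_nat_mul_two_pi, Real.sin_add_pi]
      simp only [Function.comp]
      push_cast
      rw [hs]
      ring
    have hR : HasSum (fun k : ℤ => (-1 : ℝ) ^ k * (θ + Real.pi * (k : ℝ)) *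
          Real.exp (-(θ + Real.pi * (k : ℝ)) ^ 2 / (4 * t)))
        ((2 * t ^ ((3 : ℝ) / 2) / Real.sqrt Real.pi) * A +
          -((2 * t ^ ((3 : ℝ) / 2) / Real.sqrt Real.pi) * B)) := by
      refine hasSum_int_even_odd (hR1.congr_fun fun n => ?_) (hR2.congr_fun fun n => ?_)
      · simp [zpow_mul]
      · have h1 : (-1 : ℝ) ^ (2 * n + 1) = -1 := by
          rw [zpow_add₀ (by norm_num), zpow_mul]; simp
        rw [h1]
        push_cast
        rw [show θ + Real.pi * (2 * (n : ℝ) + 1) = θ + Real.pi + Real.pi * (2 * (n : ℝ)) by ring]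
        ring
    rw [hL'.tsum_eq, hR.tsum_eq]
    have : 0 < t ^ ((3 : ℝ) / 2) := by positivity
    have : 0 < Real.sqrt Real.pi := Real.sqrt_pos.2 Real.pi_pos
    field_simp
    ring
  · intro n hn
    obtain ⟨m, rfl | rfl⟩ := n.even_or_odd'
    · have hs : Real.sin (((2 * m : ℕ) : ℝ) * (θ + Real.pi))
          = Real.sin (((2 * m : ℕ) : ℝ) * θ) := by
        push_cast
        rw [show (2 * (m : ℝ)) * (θ + Real.pi) = (2 * (m : ℝ)) * θ + m * (2 * Real.pi) by ring,
          Real.sin_add_nat_mul_two_pi]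
      rw [hs, sub_self]
    · exact absurd ⟨m, rfl⟩ hn
end

section
/- Let u : ℝ × (0,∞) → ℝ be smooth and satisfy the one-dimensional heat equation ∂u/∂t (θ,t) = ∂²u/∂θ² (θ,t). Define v(θ,t) = −e^t · (∂u/∂θ)(θ,t) / sin(θ). Then for all θ ∈ (0,π) and t > 0, v satisfies ∂v/∂t = ∂²v/∂θ² + 2·(cos θ / sin θ)·∂v/∂θ. -/
lemma aux_dir (G : ℝ × ℝ → ℝ)
    (hG : ContDiffOn ℝ (⊤ : ℕ∞) G (Set.univ ×ˢ Set.Ioi (0 : ℝ))) :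
    (∀ x t : ℝ, 0 < t → HasDerivAt (fun y => G (y, t)) (fderiv ℝ G (x, t) (1, 0)) x) ∧
    (∀ x t : ℝ, 0 < t → HasDerivAt (fun s => G (x, s)) (fderiv ℝ G (x, t) (0, 1)) t) ∧
    (∀ e : ℝ × ℝ, ContDiffOn ℝ (⊤ : ℕ∞) (fun p => fderiv ℝ G p e)
      (Set.univ ×ˢ Set.Ioi (0 : ℝ))) := by
  have hU : IsOpen ((Set.univ : Set ℝ) ×ˢ Set.Ioi (0 : ℝ)) := isOpen_univ.prod isOpen_Ioi
  have hd : ∀ x t : ℝ, 0 < t → HasFDerivAt G (fderiv ℝ G (x, t)) (x, t) := by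
    intro x t ht
    have h := hG.contDiffAt (hU.mem_nhds (show (x, t) ∈ _ from ⟨trivial, ht⟩))
    exact (h.differentiableAt (by simp)).hasFDerivAt
  refine ⟨?_, ?_, ?_⟩
  · intro x t ht
    exact (hd x t ht).comp_hasDerivAt x ((hasDerivAt_id x).prodMk (hasDerivAt_const x t))
  · intro x t ht
    exact (hd x t ht).comp_hasDerivAt t ((hasDerivAt_const t x).prodMk (hasDerivAt_id t))
  · intro e
    have h := hG.fderiv_of_isOpen (m := (⊤ : ℕ∞)) hU (by simp)
    exact h.clm_apply contDiffOn_const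

lemma aux_symm (G : ℝ × ℝ → ℝ)
    (hG : ContDiffOn ℝ (⊤ : ℕ∞) G (Set.univ ×ˢ Set.Ioi (0 : ℝ))) (x t : ℝ) (ht : 0 < t)
    (e f : ℝ × ℝ) :
    fderiv ℝ (fun p => fderiv ℝ G p e) (x, t) f = fderiv ℝ (fun p => fderiv ℝ G p f) (x, t) e := by
  have hU : IsOpen ((Set.univ : Set ℝ) ×ˢ Set.Ioi (0 : ℝ)) := isOpen_univ.prod isOpen_Ioi
  have hm := hU.mem_nhds (show (x, t) ∈ (Set.univ : Set ℝ) ×ˢ Set.Ioi (0 : ℝ) from ⟨trivial, ht⟩)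
  have h := hG.contDiffAt hm
  have hs : IsSymmSndFDerivAt ℝ G (x, t) := h.isSymmSndFDerivAt (by
    simp only [minSmoothness_of_isRCLikeNormedField]
    exact WithTop.coe_le_coe.2 (le_top : (2 : ℕ∞) ≤ ⊤))
  have hdd : DifferentiableAt ℝ (fderiv ℝ G) (x, t) :=
    ((hG.fderiv_of_isOpen (m := (⊤ : ℕ∞)) hU (by simp)).contDiffAt hm).differentiableAt (by simp)
  have key : ∀ e f : ℝ × ℝ, fderiv ℝ (fun p => fderiv ℝ G p e) (x, t) f
      = fderiv ℝ (fderiv ℝ G) (x, t) f e := by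
    intro e f
    rw [fderiv_clm_apply hdd (differentiableAt_const e)]
    simp
  rw [key, key]
  exact hs f e

/-- The `S³` intertwining relation: if `u` is a smooth solution of the one-dimensional
heat equation on `ℝ × (0,∞)`, then `v(θ,t) = -e^t ∂_θ u(θ,t) / sin θ` satisfies the
radial heat equation on the 3-sphere, `∂v/∂t = ∂²v/∂θ² + 2 cot(θ) ∂v/∂θ`,
for `θ ∈ (0,π)` and `t > 0`. -/
theorem sphere3_intertwining_relation
    (u : ℝ → ℝ → ℝ)
    (hu : ContDiffOn ℝ (⊤ : ℕ∞) (fun p : ℝ × ℝ => u p.1 p.2) (Set.univ ×ˢ Set.Ioi (0 : ℝ)))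
    (hheat : ∀ θ : ℝ, ∀ t : ℝ, 0 < t →
      deriv (fun s => u θ s) t = deriv (fun x => deriv (fun y => u y t) x) θ)
    (v : ℝ → ℝ → ℝ)
    (hv : ∀ θ t : ℝ, v θ t = -Real.exp t * deriv (fun x => u x t) θ / Real.sin θ) :
    ∀ θ ∈ Set.Ioo (0 : ℝ) Real.pi, ∀ t : ℝ, 0 < t →
      deriv (fun s => v θ s) t
        = deriv (fun x => deriv (fun y => v y t) x) θ
          + 2 * (Real.cos θ / Real.sin θ) * deriv (fun x => v x t) θ := by
  intro θ hθ t ht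
  set F : ℝ × ℝ → ℝ := fun p => u p.1 p.2 with hF
  obtain ⟨a1, a2, a3⟩ := aux_dir F hu
  set P : ℝ × ℝ → ℝ := fun p => fderiv ℝ F p (1, 0) with hP
  set Q : ℝ × ℝ → ℝ := fun p => fderiv ℝ F p (0, 1) with hQ
  obtain ⟨b1, b2, b3⟩ := aux_dir P (a3 _)
  obtain ⟨c1, -, -⟩ := aux_dir (fun p => fderiv ℝ P p (1, 0)) (b3 _)
  obtain ⟨d1, -, -⟩ := aux_dir Q (a3 _)
  have hw : ∀ x s : ℝ, 0 < s → deriv (fun y => u y s) x = P (x, s) :=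
    fun x s hs => (a1 x s hs).deriv
  have hQP : ∀ x : ℝ, Q (x, t) = fderiv ℝ P (x, t) (1, 0) := by
    intro x
    have h1 : deriv (fun s => u x s) t = Q (x, t) := (a2 x t ht).deriv
    rw [← h1, hheat x t ht]
    have h2 : (fun x => deriv (fun y => u y t) x) = fun x => P (x, t) :=
      funext fun x => hw x t ht
    rw [h2]
    exact (b1 x t ht).deriv
  set w : ℝ → ℝ := fun x => P (x, t) with hwd
  set w1 : ℝ → ℝ := fun x => fderiv ℝ P (x, t) (1, 0) with hw1
  set w2 : ℝ := fderiv ℝ (fun p => fderiv ℝ P p (1, 0)) (θ, t) (1, 0) with hw2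
  have hdw : ∀ x, HasDerivAt w (w1 x) x := fun x => b1 x t ht
  have hdw1 : HasDerivAt w1 w2 θ := c1 θ t ht
  have hPt : HasDerivAt (fun s => P (θ, s)) w2 t := by
    have h := b2 θ t ht
    have e1 : fderiv ℝ P (θ, t) (0, 1) = fderiv ℝ Q (θ, t) (1, 0) :=
      aux_symm F hu θ t ht (1, 0) (0, 1)
    have e2 : HasDerivAt (fun y => Q (y, t)) (fderiv ℝ Q (θ, t) (1, 0)) θ := d1 θ t ht
    rw [show (fun y => Q (y, t)) = w1 from funext hQP] at e2
    rw [e1, e2.unique hdw1] at h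
    exact h
  have hsin : Real.sin θ ≠ 0 := (Real.sin_pos_of_pos_of_lt_pi hθ.1 hθ.2).ne'
  have hvt : HasDerivAt (fun s => v θ s)
      ((-Real.exp t * P (θ, t) + -Real.exp t * w2) / Real.sin θ) t := by
    have h := (((Real.hasDerivAt_exp t).fun_neg).fun_mul hPt).div_const (Real.sin θ)
    refine h.congr_of_eventuallyEq ?_
    filter_upwards [Ioi_mem_nhds ht] with s hs
    rw [hv, hw θ s hs]
  have hvf : (fun y => v y t) = fun y => -Real.exp t * w y / Real.sin y := by
    funext y
    rw [hv, hw y t ht]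
  have hvx : ∀ x, Real.sin x ≠ 0 → HasDerivAt (fun y => v y t)
      ((-Real.exp t * w1 x * Real.sin x - -Real.exp t * w x * Real.cos x) / Real.sin x ^ 2) x := by
    intro x hx
    rw [hvf]
    exact ((hdw x).const_mul (-Real.exp t)).fun_div (Real.hasDerivAt_sin x) hx
  have hvxx := (((hdw1.const_mul (-Real.exp t)).fun_mul (Real.hasDerivAt_sin θ)).fun_sub
    (((hdw θ).const_mul (-Real.exp t)).fun_mul (Real.hasDerivAt_cos θ))).fun_div
    ((Real.hasDerivAt_sin θ).fun_pow 2) (pow_ne_zero 2 hsin)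
  have hev : (fun x => deriv (fun y => v y t) x) =ᶠ[nhds θ] fun x =>
      (-Real.exp t * w1 x * Real.sin x - -Real.exp t * w x * Real.cos x) / Real.sin x ^ 2 := by
    filter_upwards [Ioo_mem_nhds hθ.1 hθ.2] with x hx
    exact (hvx x (Real.sin_pos_of_pos_of_lt_pi hx.1 hx.2).ne').deriv
  rw [hvt.deriv, (hvxx.congr_of_eventuallyEq hev).deriv, (hvx θ hsin).deriv]
  have hwP : P (θ, t) = w θ := rfl
  rw [hwP]
  generalize w θ = A
  generalize w1 θ = B
  generalize w2 = C
  have hc : Real.cos θ ^ 2 = 1 - Real.sin θ ^ 2 := Real.cos_sq' θ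
  field_simp
  ring_nf
end

section
/- The function K₃(θ,t) = e^t · (4πt)^{−3/2} · Σ_{k∈ℤ} ((θ + 2πk)/sin θ) · exp(−(θ+2πk)²/(4t)) satisfies, for all θ ∈ (0,π) and t > 0, the radial heat equation on the 3-sphere: ∂K₃/∂t = ∂²K₃/∂θ² + 2·(cos θ / sin θ)·∂K₃/∂θ. -/
lemma s3_bound_summable (m : ℕ) {T : ℝ} (hT : 0 < T) :
    Summable (fun k : ℤ => (2 * Real.pi * (|(k : ℝ)| + 1)) ^ m *
      Real.exp (-((2 * Real.pi * (k : ℝ)) ^ 2 / 2 - Real.pi ^ 2) / (4 * T))) := by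
  have hpi := Real.pi_pos
  have hT' : 0 < Real.pi / (2 * T) := by positivity
  have h0 := summable_pow_mul_jacobiTheta₂_term_bound 0 hT' 0
  have h1 := summable_pow_mul_jacobiTheta₂_term_bound 0 hT' m
  have h2 := (h1.add h0).mul_left
    ((2 * Real.pi) ^ m * 2 ^ (m - 1) * Real.exp (Real.pi ^ 2 / (4 * T)))
  refine Summable.of_nonneg_of_le (fun k => by positivity) (fun k => ?_) h2
  have e : Real.exp (-((2 * Real.pi * (k : ℝ)) ^ 2 / 2 - Real.pi ^ 2) / (4 * T))
      = Real.exp (Real.pi ^ 2 / (4 * T)) *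
        Real.exp (-Real.pi * (Real.pi / (2 * T) * (k : ℝ) ^ 2 - 2 * 0 * |(k : ℤ)|)) := by
    rw [← Real.exp_add]
    congr 1
    field_simp
    ring
  rw [e, mul_pow]
  have h3 : (|(k : ℝ)| + 1) ^ m ≤ 2 ^ (m - 1) * (|(k : ℝ)| ^ m + 1 ^ m) :=
    add_pow_le (abs_nonneg _) zero_le_one m
  have h4 := mul_le_mul_of_nonneg_left h3 (show 0 ≤ (2 * Real.pi) ^ m *
    (Real.exp (Real.pi ^ 2 / (4 * T)) *
        Real.exp (-Real.pi * (Real.pi / (2 * T) * (k : ℝ) ^ 2 - 2 * 0 * |(k : ℤ)|))) by positivity)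
  push_cast at h4 ⊢
  simp only [one_pow, pow_zero] at h4 ⊢
  linarith

/-- terms of the series -/
noncomputable def s3term (m : ℕ) (x t : ℝ) (k : ℤ) : ℝ :=
  (x + 2 * Real.pi * (k : ℝ)) ^ m * Real.exp (-(x + 2 * Real.pi * (k : ℝ)) ^ 2 / (4 * t))

lemma s3term_le (m : ℕ) {T t x : ℝ} (ht : 0 < t) (htT : t ≤ T)
    (hx : x ∈ Set.Ioo 0 Real.pi) (k : ℤ) :
    |s3term m x t k| ≤ (2 * Real.pi * (|(k : ℝ)| + 1)) ^ m *
      Real.exp (-((2 * Real.pi * (k : ℝ)) ^ 2 / 2 - Real.pi ^ 2) / (4 * T)) := by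
  have hpi := Real.pi_pos
  obtain ⟨hx0, hx1⟩ := hx
  unfold s3term
  rw [abs_mul, abs_pow, abs_of_pos (Real.exp_pos _)]
  gcongr ?_ ^ m * Real.exp ?_
  · calc |x + 2 * Real.pi * (k : ℝ)| ≤ |x| + |2 * Real.pi * (k : ℝ)| := abs_add_le _ _
      _ = x + 2 * Real.pi * |(k : ℝ)| := by
        rw [abs_of_pos hx0, abs_mul, abs_of_pos (by positivity : 0 < 2 * Real.pi)]
      _ ≤ _ := by nlinarith
  · have hT : 0 < T := ht.trans_le htT
    have a1 : (x + 2 * Real.pi * (k : ℝ)) ^ 2 / (4 * T)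
        ≤ (x + 2 * Real.pi * (k : ℝ)) ^ 2 / (4 * t) := by gcongr
    have a2 : ((2 * Real.pi * (k : ℝ)) ^ 2 / 2 - Real.pi ^ 2) / (4 * T)
        ≤ (x + 2 * Real.pi * (k : ℝ)) ^ 2 / (4 * T) := by
      gcongr
      nlinarith [sq_nonneg (2 * Real.pi * (k : ℝ) + 2 * x)]
    rw [neg_div, neg_div]
    linarith

lemma s3term_summable (m : ℕ) {t x : ℝ} (ht : 0 < t) (hx : x ∈ Set.Ioo 0 Real.pi) :
    Summable (s3term m x t) :=
  Summable.of_norm_bounded (s3_bound_summable m ht) (fun k => s3term_le m ht le_rfl hx k)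

noncomputable def s3sum (m : ℕ) (x t : ℝ) : ℝ := ∑' k : ℤ, s3term m x t k

lemma s3sum_hasDerivAt_x (m : ℕ) {t x : ℝ} (ht : 0 < t) (hx : x ∈ Set.Ioo 0 Real.pi) :
    HasDerivAt (fun y => s3sum m y t)
      (m * s3sum (m - 1) x t - s3sum (m + 1) x t / (2 * t)) x := by
  have hu := ((s3_bound_summable (m - 1) ht).mul_left (m : ℝ)).add
    ((s3_bound_summable (m + 1) ht).div_const (2 * t))
  have key := hasDerivAt_tsum_of_isPreconnected (g := fun k y => s3term m y t k)
    (g' := fun k y => m * s3term (m - 1) y t k - s3term (m + 1) y t k / (2 * t))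
    hu isOpen_Ioo isPreconnected_Ioo ?_ ?_ hx (s3term_summable m ht hx) hx
  · unfold s3sum
    rw [Summable.tsum_sub ((s3term_summable _ ht hx).mul_left _)
      ((s3term_summable _ ht hx).div_const _), tsum_mul_left, tsum_div_const] at key
    exact key
  · intro k y hy
    have h1 : HasDerivAt (fun y : ℝ => y + 2 * Real.pi * (k : ℝ)) 1 y :=
      (hasDerivAt_id y).add_const _
    have h2 := (h1.pow m).mul (((h1.pow 2).neg.div_const (4 * t)).exp)
    refine h2.congr_deriv ?_
    simp only [s3term, Pi.pow_apply, Pi.neg_apply]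
    field_simp
    push_cast
    ring
  · intro k y hy
    refine (norm_sub_le _ _).trans ?_
    rw [norm_mul, norm_div, Real.norm_of_nonneg (by positivity : (0 : ℝ) ≤ 2 * t), RCLike.norm_natCast]
    gcongr
    · exact s3term_le _ ht le_rfl hy k
    · exact s3term_le _ ht le_rfl hy k

lemma s3sum_hasDerivAt_t (m : ℕ) {t x : ℝ} (ht : 0 < t) (hx : x ∈ Set.Ioo 0 Real.pi) :
    HasDerivAt (fun s => s3sum m x s) (s3sum (m + 2) x t / (4 * t ^ 2)) t := by
  have hmem : t ∈ Set.Ioo (t / 2) (2 * t) := ⟨by linarith, by linarith⟩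
  have hu := (s3_bound_summable (m + 2) (by positivity : 0 < 2 * t)).div_const (4 * (t / 2) ^ 2)
  have key := hasDerivAt_tsum_of_isPreconnected (g := fun k s => s3term m x s k)
    (g' := fun k s => s3term (m + 2) x s k / (4 * s ^ 2))
    hu isOpen_Ioo isPreconnected_Ioo ?_ ?_ hmem (s3term_summable m ht hx) hmem
  · unfold s3sum
    rw [tsum_div_const] at key
    exact key
  · intro k s hs
    have hs0 : 0 < s := by linarith [hs.1]
    have h1 : HasDerivAt (fun s : ℝ => 4 * s) 4 s := by
      simpa using (hasDerivAt_id s).const_mul 4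
    have h2 := ((((hasDerivAt_const s (-(x + 2 * Real.pi * (k : ℝ)) ^ 2)).div h1
      (by positivity)).exp).const_mul ((x + 2 * Real.pi * (k : ℝ)) ^ m))
    refine h2.congr_deriv ?_
    simp only [s3term, Pi.div_apply]
    field_simp
    ring
  · intro k s hs
    have hs0 : 0 < s := by linarith [hs.1]
    rw [norm_div, Real.norm_of_nonneg (by positivity : (0 : ℝ) ≤ 4 * s ^ 2)]
    have := hs.1.le
    gcongr
    exact s3term_le _ hs0 hs.2.le hx k

/-- The sum-over-paths heat kernel on the 3-sphere,
`K₃(θ,t) = e^t (4πt)^{-3/2} Σ_{k∈ℤ} ((θ+2πk)/sin θ) e^{-(θ+2πk)²/(4t)}`,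
satisfies the radial heat equation `∂K₃/∂t = ∂²K₃/∂θ² + 2 cot(θ) ∂K₃/∂θ`
for `θ ∈ (0,π)` and `t > 0`. -/
theorem sphere3_sum_over_paths_solves_radial_heat_equation
    (K : ℝ → ℝ → ℝ)
    (hK : ∀ θ t : ℝ, K θ t = Real.exp t * (4 * Real.pi * t) ^ (-(3 : ℝ) / 2) *
      ∑' k : ℤ, ((θ + 2 * Real.pi * (k : ℝ)) / Real.sin θ) *
        Real.exp (-(θ + 2 * Real.pi * (k : ℝ)) ^ 2 / (4 * t))) :
    ∀ θ ∈ Set.Ioo (0 : ℝ) Real.pi, ∀ t : ℝ, 0 < t →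
      deriv (fun s => K θ s) t
        = deriv (fun x => deriv (fun y => K y t) x) θ
          + 2 * (Real.cos θ / Real.sin θ) * deriv (fun x => K x t) θ := by
  intro θ hθ t ht
  have hpi := Real.pi_pos
  have hK' : ∀ θ t : ℝ, K θ t = Real.exp t * (4 * Real.pi * t) ^ (-(3 : ℝ) / 2) *
      (s3sum 1 θ t / Real.sin θ) := by
    intro θ t
    rw [hK, s3sum, ← tsum_div_const]
    congr 2
    ext k
    simp only [s3term, pow_one]
    ring
  have hsin : ∀ x ∈ Set.Ioo (0 : ℝ) Real.pi, Real.sin x ≠ 0 := fun x hx =>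
    (Real.sin_pos_of_mem_Ioo hx).ne'
  simp only [hK']
  set C : ℝ → ℝ := fun t => Real.exp t * (4 * Real.pi * t) ^ (-(3 : ℝ) / 2) with hC
  have hCd : HasDerivAt C (C t * (1 - 3 / (2 * t))) t := by
    have h1 : HasDerivAt (fun s : ℝ => 4 * Real.pi * s) (4 * Real.pi) t := by
      simpa using (hasDerivAt_id t).const_mul (4 * Real.pi)
    have hpos : 0 < 4 * Real.pi * t := by positivity
    have h2 := (Real.hasDerivAt_exp t).mul (h1.rpow_const (p := -(3 : ℝ) / 2) (Or.inl hpos.ne'))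
    refine h2.congr_deriv ?_
    rw [Real.rpow_sub_one hpos.ne']
    simp only [hC]
    field_simp
    ring
  have d1 : ∀ x ∈ Set.Ioo (0 : ℝ) Real.pi, HasDerivAt (fun y => C t * (s3sum 1 y t / Real.sin y))
      (C t * (((s3sum 0 x t - s3sum 2 x t / (2 * t)) * Real.sin x - s3sum 1 x t * Real.cos x)
        / Real.sin x ^ 2)) x := by
    intro x hx
    have := ((s3sum_hasDerivAt_x 1 ht hx).div (Real.hasDerivAt_sin x) (hsin x hx)).const_mul (C t)
    refine this.congr_deriv ?_
    norm_num
  have dt : HasDerivAt (fun s => C s * (s3sum 1 θ s / Real.sin θ)) _ t :=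
    hCd.mul ((s3sum_hasDerivAt_t 1 ht hθ).div_const (Real.sin θ))
  have d2 : deriv (fun x => deriv (fun y => C t * (s3sum 1 y t / Real.sin y)) x) θ
     = deriv (fun x => C t * (((s3sum 0 x t - s3sum 2 x t / (2 * t)) * Real.sin x
        - s3sum 1 x t * Real.cos x) / Real.sin x ^ 2)) θ := by
    apply Filter.EventuallyEq.deriv_eq
    filter_upwards [isOpen_Ioo.mem_nhds hθ] with x hx
    exact (d1 x hx).deriv
  have hs := hsin θ hθ
  have e0 := s3sum_hasDerivAt_x 0 ht hθ
  have e1 := s3sum_hasDerivAt_x 1 ht hθ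
  have e2 := s3sum_hasDerivAt_x 2 ht hθ
  have d3 : HasDerivAt (fun x => C t * (((s3sum 0 x t - s3sum 2 x t / (2 * t)) * Real.sin x
        - s3sum 1 x t * Real.cos x) / Real.sin x ^ 2)) _ θ :=
    (((((e0.sub (e2.div_const (2 * t))).mul (Real.hasDerivAt_sin θ)).sub
      (e1.mul (Real.hasDerivAt_cos θ))).div ((Real.hasDerivAt_sin θ).pow 2)
        (pow_ne_zero 2 hs)).const_mul (C t))
  change deriv (fun s => C s * (s3sum 1 θ s / Real.sin θ)) t =
    deriv (fun x => deriv (fun y => C t * (s3sum 1 y t / Real.sin y)) x) θ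
     + 2 * (Real.cos θ / Real.sin θ) * deriv (fun y => C t * (s3sum 1 y t / Real.sin y)) θ
  rw [d2, d3.deriv, dt.deriv, (d1 θ hθ).deriv]
  simp only [Pi.pow_apply, Pi.mul_apply, Pi.sub_apply, Pi.div_apply]
  norm_num
  clear_value C
  field_simp
  ring
end

section
/- Fix a natural number l and define the Legendre polynomial by Rodrigues' formula P_l(x) = (1/(2^l · l!)) · d^l/dx^l [(x² − 1)^l]. Then the function f(θ) = P_l(cos θ) satisfies f''(θ) + (cos θ / sin θ)·f'(θ) = −l(l+1)·f(θ) for all θ ∈ (0,π). -/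
open Polynomial in
theorem legendre_aux_ode (l k : ℕ) :
    ((X : ℝ[X]) ^ 2 - 1) * derivative^[k + 2] (((X : ℝ[X]) ^ 2 - 1) ^ l)
      + 2 * ((k : ℝ[X]) + 1) * X * derivative^[k + 1] (((X : ℝ[X]) ^ 2 - 1) ^ l)
      + (k : ℝ[X]) * ((k : ℝ[X]) + 1) * derivative^[k] (((X : ℝ[X]) ^ 2 - 1) ^ l)
    = 2 * (l : ℝ[X]) * (X * derivative^[k + 1] (((X : ℝ[X]) ^ 2 - 1) ^ l)
      + ((k : ℝ[X]) + 1) * derivative^[k] (((X : ℝ[X]) ^ 2 - 1) ^ l)) := by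
  have hd : derivative ((X : ℝ[X]) ^ 2 - 1) = 2 * X := by
    simp; norm_num
  have hb : ((X : ℝ[X]) ^ 2 - 1) * derivative (((X : ℝ[X]) ^ 2 - 1) ^ l)
      = 2 * (l : ℝ[X]) * (X * ((X : ℝ[X]) ^ 2 - 1) ^ l) := by
    rw [derivative_pow, hd]
    cases l with
    | zero => simp
    | succ n => simp only [Nat.add_sub_cancel, C_eq_natCast]; ring
  have h2 : derivative (2 : ℝ[X]) = 0 := derivative_ofNat 2
  generalize ((X : ℝ[X]) ^ 2 - 1) ^ l = u at hb ⊢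
  induction k with
  | zero =>
    have := congrArg derivative hb
    simp only [derivative_mul, hd, h2, derivative_natCast, derivative_X] at this
    simp only [Function.iterate_succ_apply', Function.iterate_zero, id]
    push_cast
    linear_combination this
  | succ k ih =>
    have := congrArg derivative ih
    simp only [derivative_mul, derivative_add, hd, h2, derivative_natCast, derivative_X,
      derivative_one, Function.iterate_succ_apply'] at this
    simp only [Function.iterate_succ_apply']
    push_cast
    linear_combination this

/-- The Legendre polynomials (via Rodrigues' formula) evaluated at `cos θ` are radial
eigenfunctions of the Laplace–Beltrami operator on the 2-sphere:
`f'' + cot(θ) f' = -l(l+1) f` on `(0,π)`, where `f(θ) = P_l(cos θ)`. -/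
theorem sphere2_legendre_radial_eigenfunctions (l : ℕ)
    (P : ℝ → ℝ)
    (hP : ∀ x : ℝ, P x = (1 / ((2 : ℝ) ^ l * (Nat.factorial l : ℝ))) *
      iteratedDeriv l (fun y => (y ^ 2 - 1) ^ l) x)
    (f : ℝ → ℝ) (hf : ∀ θ : ℝ, f θ = P (Real.cos θ)) :
    ∀ θ ∈ Set.Ioo (0 : ℝ) Real.pi,
      deriv (deriv f) θ + (Real.cos θ / Real.sin θ) * deriv f θ
        = -((l : ℝ) * ((l : ℝ) + 1)) * f θ := by
  intro θ hθ
  have hs : Real.sin θ ≠ 0 := (Real.sin_pos_of_mem_Ioo hθ).ne'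
  generalize 1 / ((2 : ℝ) ^ l * (Nat.factorial l : ℝ)) = c at hP
  have hit : ∀ k : ℕ, ∀ p : Polynomial ℝ, iteratedDeriv k (fun y => p.eval y)
      = fun y => (Polynomial.derivative^[k] p).eval y := by
    intro k
    induction k with
    | zero => intro p; simp
    | succ k ih =>
      intro p
      rw [iteratedDeriv_succ, ih p]
      funext y
      rw [Polynomial.deriv, Function.iterate_succ_apply']
  have hfun : (fun y : ℝ => (y ^ 2 - 1) ^ l)
      = fun y => (((Polynomial.X : Polynomial ℝ) ^ 2 - 1) ^ l).eval y := by
    funext y; simp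
  have hode := congrArg (Polynomial.eval (Real.cos θ)) (legendre_aux_ode l l)
  simp only [Function.iterate_succ_apply'] at hode
  rw [hfun, hit] at hP
  generalize Polynomial.derivative^[l] (((Polynomial.X : Polynomial ℝ) ^ 2 - 1) ^ l) = Q at hP hode
  have hf0 : f = fun t => c * Q.eval (Real.cos t) := by
    funext t; rw [hf, hP]
  have hc : ∀ (R : Polynomial ℝ) (t : ℝ), HasDerivAt (fun t => R.eval (Real.cos t))
      (R.derivative.eval (Real.cos t) * (-Real.sin t)) t := fun R t =>
    (R.hasDerivAt (Real.cos t)).comp t (Real.hasDerivAt_cos t)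
  have hf1 : deriv f = fun t => c * (Q.derivative.eval (Real.cos t) * (-Real.sin t)) := by
    funext t; rw [hf0]; exact ((hc Q t).const_mul c).deriv
  have hf2 := (((hc Q.derivative θ).mul (Real.hasDerivAt_sin θ).neg).const_mul c).deriv
  have hf2' : deriv (deriv f) θ = c * (Q.derivative.derivative.eval (Real.cos θ) * (-Real.sin θ)
      * (-Real.sin θ) + Q.derivative.eval (Real.cos θ) * (-Real.cos θ)) := by
    rw [hf1]; exact hf2
  rw [hf2', hf1, hf0]
  simp at hode
  have hsc := Real.sin_sq_add_cos_sq θ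
  field_simp
  linear_combination (-c) * hode
    + c * Q.derivative.derivative.eval (Real.cos θ) * hsc
end

section
/- Let T > 0, let f : ℝ^d × [0,T] → ℝ^d be smooth, g : [0,T] → ℝ continuous, and let p : ℝ^d × [0,T] → ℝ be smooth and everywhere positive, satisfying the Fokker–Planck equation ∂_t p(x,t) = −div_x(p(x,t) f(x,t)) + (g(t)²/2) Δ_x p(x,t). Define q(x,s) = p(x, T−s). Then q satisfies ∂_s q(x,s) = −div_x( q(x,s)·( −f(x,T−s) + g(T−s)²·∇_x log q(x,s) ) ) + (g(T−s)²/2)·Δ_x q(x,s). That is, the time-reversed marginals satisfy the Fokker–Planck equation of the reverse SDE dx = (f − g²∇log p) dt + g dB̄ run backwards in time. -/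
/-- Divergence of a vector field on `ℝ^d`: the sum of the partial derivatives
of the coordinate functions. -/
noncomputable def divergence {d : ℕ}
    (v : EuclideanSpace ℝ (Fin d) → EuclideanSpace ℝ (Fin d))
    (x : EuclideanSpace ℝ (Fin d)) : ℝ :=
  ∑ i : Fin d, fderiv ℝ v x (EuclideanSpace.single i 1) i

/-- Laplacian of a scalar function on `ℝ^d`: the sum of the second partial derivatives. -/
noncomputable def laplacian {d : ℕ}
    (p : EuclideanSpace ℝ (Fin d) → ℝ) (x : EuclideanSpace ℝ (Fin d)) : ℝ :=
  ∑ i : Fin d,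
    fderiv ℝ (fun y => fderiv ℝ p y (EuclideanSpace.single i 1)) x (EuclideanSpace.single i 1)

theorem gradient_apply_single {d : ℕ} (u : EuclideanSpace ℝ (Fin d) → ℝ)
    (y : EuclideanSpace ℝ (Fin d)) (i : Fin d) :
    gradient u y i = fderiv ℝ u y (EuclideanSpace.single i 1) := by
  have h : inner ℝ (gradient u y) (EuclideanSpace.single i (1 : ℝ))
      = fderiv ℝ u y (EuclideanSpace.single i 1) := by
    rw [gradient, InnerProductSpace.toDual_symm_apply]
  rw [← h, EuclideanSpace.inner_single_right]
  simp

theorem smul_gradient_log {d : ℕ} (u : EuclideanSpace ℝ (Fin d) → ℝ)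
    (y : EuclideanSpace ℝ (Fin d)) (hu : DifferentiableAt ℝ u y) (h0 : u y ≠ 0) :
    u y • gradient (fun z => Real.log (u z)) y = gradient u y := by
  ext i
  rw [PiLp.smul_apply, gradient_apply_single, gradient_apply_single, fderiv.log hu h0]
  simp [h0]

theorem differentiable_gradient {d : ℕ} (u : EuclideanSpace ℝ (Fin d) → ℝ)
    (hu : ContDiff ℝ 2 u) : Differentiable ℝ (fun y => gradient u y) := by
  have h : Differentiable ℝ (fderiv ℝ u) :=
    (hu.fderiv_right (m := 1) (by norm_num)).differentiable (by norm_num)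
  rw [differentiable_euclidean]
  intro i
  simp only [gradient_apply_single]
  exact h.clm_apply (differentiable_const _)

theorem fderiv_coord {d : ℕ} (v : EuclideanSpace ℝ (Fin d) → EuclideanSpace ℝ (Fin d))
    (x e : EuclideanSpace ℝ (Fin d)) (i : Fin d) (hv : DifferentiableAt ℝ v x) :
    fderiv ℝ v x e i = fderiv ℝ (fun y => v y i) x e := by
  have h := ((EuclideanSpace.proj i : EuclideanSpace ℝ (Fin d) →L[ℝ] ℝ).hasFDerivAt.comp x
    hv.hasFDerivAt).fderiv
  have h2 : fderiv ℝ (fun y => v y i) x = _ := h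
  rw [h2]
  rfl

theorem divergence_gradient {d : ℕ} (u : EuclideanSpace ℝ (Fin d) → ℝ)
    (hu : ContDiff ℝ 2 u) (x : EuclideanSpace ℝ (Fin d)) :
    divergence (fun y => gradient u y) x = laplacian u x := by
  unfold divergence laplacian
  refine Finset.sum_congr rfl fun i _ => ?_
  rw [fderiv_coord _ _ _ _ (differentiable_gradient u hu x)]
  simp only [gradient_apply_single]

theorem divergence_combo {d : ℕ} (v w : EuclideanSpace ℝ (Fin d) → EuclideanSpace ℝ (Fin d))
    (c : ℝ) (x : EuclideanSpace ℝ (Fin d)) (hv : DifferentiableAt ℝ v x)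
    (hw : DifferentiableAt ℝ w x) :
    divergence (fun y => -v y + c • w y) x = -divergence v x + c * divergence w x := by
  unfold divergence
  rw [fderiv_fun_add hv.fun_neg (hw.fun_const_smul c), fderiv_fun_neg, fderiv_fun_const_smul hw c,
    Finset.mul_sum, ← Finset.sum_neg_distrib, ← Finset.sum_add_distrib]
  refine Finset.sum_congr rfl fun i _ => ?_
  simp

/-- Time reversal of the Fokker–Planck equation: if the smooth positive density `p`
satisfies `∂_t p = -div(p f) + (g²/2) Δp` on `[0,T]`, then `q(x,s) = p(x, T-s)`
satisfies the Fokker–Planck equation of the reverse SDE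
`dx = (f - g² ∇ log p) dt + g dB̄` run backwards in time:
`∂_s q = -div(q (-f(·,T-s) + g(T-s)² ∇ log q)) + (g(T-s)²/2) Δq`. -/
theorem time_reversed_marginals_satisfy_reverse_fokker_planck
    (d : ℕ) (T : ℝ) (hT : 0 < T)
    (f : EuclideanSpace ℝ (Fin d) → ℝ → EuclideanSpace ℝ (Fin d))
    (g : ℝ → ℝ)
    (p : EuclideanSpace ℝ (Fin d) → ℝ → ℝ)
    (hf : ContDiff ℝ (⊤ : ℕ∞) (fun q : EuclideanSpace ℝ (Fin d) × ℝ => f q.1 q.2))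
    (hg : Continuous g)
    (hp : ContDiff ℝ (⊤ : ℕ∞) (fun q : EuclideanSpace ℝ (Fin d) × ℝ => p q.1 q.2))
    (hpos : ∀ x t, 0 < p x t)
    (hFP : ∀ x, ∀ t ∈ Set.Icc (0 : ℝ) T, deriv (fun τ => p x τ) t
      = -divergence (fun y => p y t • f y t) x + (g t ^ 2 / 2) * laplacian (fun y => p y t) x)
    (q : EuclideanSpace ℝ (Fin d) → ℝ → ℝ)
    (hq : ∀ x s, q x s = p x (T - s)) :
    ∀ x, ∀ s ∈ Set.Icc (0 : ℝ) T, deriv (fun σ => q x σ) s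
      = -divergence (fun y => q y s •
            (-f y (T - s) + g (T - s) ^ 2 • gradient (fun z => Real.log (q z s)) y)) x
        + (g (T - s) ^ 2 / 2) * laplacian (fun y => q y s) x := by
  intro x s hs
  have hq' : q = fun x s => p x (T - s) := by
    funext x s
    exact hq x s
  subst hq'
  have hpt : ContDiff ℝ (⊤ : ℕ∞) (fun y => p y (T - s)) :=
    hp.comp (contDiff_id.prodMk contDiff_const)
  have hft : ContDiff ℝ (⊤ : ℕ∞) (fun y => f y (T - s)) :=
    hf.comp (contDiff_id.prodMk contDiff_const)
  have hp2 : ContDiff ℝ 2 (fun y => p y (T - s)) := contDiff_infty.1 hpt 2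
  have hpd : Differentiable ℝ (fun y => p y (T - s)) := hpt.differentiable (by simp)
  have hfd : Differentiable ℝ (fun y => f y (T - s)) := hft.differentiable (by simp)
  have hfield : (fun y => p y (T - s) •
      (-f y (T - s) + g (T - s) ^ 2 • gradient (fun z => Real.log (p z (T - s))) y))
      = fun y => -(p y (T - s) • f y (T - s))
        + g (T - s) ^ 2 • gradient (fun z => p z (T - s)) y := by
    funext y
    rw [smul_add, smul_neg, smul_comm,
      smul_gradient_log (fun z => p z (T - s)) y (hpd y) (hpos y _).ne']
  have hmem : T - s ∈ Set.Icc (0 : ℝ) T := ⟨by linarith [hs.2], by linarith [hs.1]⟩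
  have hd : deriv (fun σ => p x (T - σ)) s = -deriv (fun τ => p x τ) (T - s) :=
    deriv_comp_const_sub (f := fun τ => p x τ) T s
  simp only []
  rw [hfield, divergence_combo (fun y => p y (T - s) • f y (T - s)) _ _ _
    ((hpd x).smul (hfd x)) (differentiable_gradient _ hp2 x), divergence_gradient _ hp2, hd,
    hFP x _ hmem]
  ring
end
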